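/- Let (α,β) ∈ P × P̄. (i) If (α,β) is right extremal, then (α, ξ_α(β)) belongs to the lexicographic world LW. (ii) If (α,β) is left extremal, then (ξ'_β(α), β) belongs to LW. -/

import Mathlib

open Filter MeasureTheory

namespace DoublingHole

/-- One-sided binary sequences (indexed from 0, corresponding to x₁x₂x₃⋯). -/
abbrev Seq : Type := ℕ → Bool

/-- The one-sided shift map σ. -/
def shift (x : Seq) : Seq := fun n => x (n + 1)

/-- Strict lexicographic order ≺ on sequences. -/
def lexLt (x y : Seq) : Prop := ∃ k : ℕ, (∀ i, i < k → x i = y i) ∧ x k < y k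

/-- Reflexive lexicographic order ≼ on sequences. -/
def lexLe (x y : Seq) : Prop := lexLt x y ∨ x = y

/-- The lexicographic subshift Σ_{(α,β)} = {x : β ≼ σⁿx ≼ α for all n ≥ 0}. -/
def lexSubshift (α β : Seq) : Set Seq :=
  {x | ∀ n : ℕ, lexLe β (shift^[n] x) ∧ lexLe (shift^[n] x) α}

/-- The projection π : Σ₂ → [0,1], π(x) = Σ xᵢ 2^{-i}. -/
noncomputable def piMap (x : Seq) : ℝ := ∑' i : ℕ, if x i then (1 : ℝ) / 2 ^ (i + 1) else 0

/-- The mirror image x̄ of a sequence. -/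
def mirror (x : Seq) : Seq := fun n => !(x n)

/-- The set P of Parry sequences: α₁ = 1 and σⁿα ≼ α for all n ≥ 1. -/
def ParryP : Set Seq := {α | α 0 = true ∧ ∀ n, 1 ≤ n → lexLe (shift^[n] α) α}

/-- The set P̄ of mirror images of Parry sequences. -/
def barP : Set Seq := {β | mirror β ∈ ParryP}

/-- Periodic sequences. -/
def PerSet : Set Seq := {x | ∃ k, 1 ≤ k ∧ shift^[k] x = x}

/-- Membership in the lexicographic world LW. -/
def inLW (α β : Seq) : Prop :=
  α ∈ ParryP ∧ β ∈ barP ∧ ∀ n, 1 ≤ n → lexLe β (shift^[n] α) ∧ lexLe (shift^[n] β) α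

/-- The doubling map x ↦ 2x (mod 1) on S¹ identified with [0,1). -/
noncomputable def dbl (x : ℝ) : ℝ := Int.fract (2 * x)

/-- The exceptional set X_{(a,b)} of points whose orbit avoids the hole (a,b). -/
def Xset (a b : ℝ) : Set ℝ :=
  {x | x ∈ Set.Ico (0 : ℝ) 1 ∧ ∀ n : ℕ, dbl^[n] x ∉ Set.Ioo a b}

/-- The attractor Λ_{(a,b)} = [2b-1, 2a] ∩ X_{(a,b)}. -/
def Lam (a b : ℝ) : Set ℝ := Set.Icc (2 * b - 1) (2 * a) ∩ Xset a b

/-- χ(a) = sup{b : X_{(a,b)} is uncountable}. -/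
noncomputable def chiFn (a : ℝ) : ℝ :=
  sSup {b | b ∈ Set.Ico (0 : ℝ) 1 ∧ ¬ (Xset a b).Countable}

/-- The parameter region D₁. -/
def D1 : Set (ℝ × ℝ) :=
  {p | p.1 ∈ Set.Ioo (1/4 : ℝ) (1/2) ∧ p.2 ∈ Set.Ioo (1/2 : ℝ) (3/4) ∧ p.2 ≤ chiFn p.1}

/-- The set S of parameters whose endpoints both fall into the hole. -/
def Sset : Set (ℝ × ℝ) :=
  {p | p ∈ D1 ∧ (∃ n, 1 ≤ n ∧ dbl^[n] p.1 ∈ Set.Ioo p.1 p.2) ∧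
        ∃ m, 1 ≤ m ∧ dbl^[m] p.2 ∈ Set.Ioo p.1 p.2}

/-- The finite word w occurs in (is a factor of) the sequence x. -/
def occursIn (w : List Bool) (x : Seq) : Prop :=
  ∃ i : ℕ, w = List.ofFn fun j : Fin w.length => x (i + (j : ℕ))

/-- The language of a subshift: all finite factors of its elements. -/
def Lang (A : Set Seq) : Set (List Bool) := {w | ∃ x ∈ A, occursIn w x}

/-- A set of sequences is a subshift of finite type if it is defined by
finitely many forbidden words. -/
def IsSFT (A : Set Seq) : Prop :=
  ∃ F : Finset (List Bool), A = {x | ∀ w ∈ F, ¬ occursIn w x}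

/-- B_n(A): the admissible words of length n. -/
def wordsOfLen (A : Set Seq) (n : ℕ) : Set (List Bool) :=
  {w | w.length = n ∧ w ∈ Lang A}

/-- Topological transitivity of a subshift, phrased via its language. -/
def TransitiveShift (A : Set Seq) : Prop :=
  ∀ u ∈ Lang A, ∀ v ∈ Lang A, ∃ t ∈ Lang A, u ++ t ++ v ∈ Lang A

/-- Cyclic rotation of a finite word. -/
def rot (w : List Bool) (k : ℕ) : List Bool := w.drop k ++ w.take k

/-- Lexicographic (dictionary) order on finite words. -/
def listLe (u v : List Bool) : Prop := List.Lex (· < ·) u v ∨ u = v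

/-- w = 0-max_w : w starts with 0 and is the lexicographically largest
cyclic permutation of itself starting with 0. -/
def isZeroMax (w : List Bool) : Prop :=
  w.headD true = false ∧
    ∀ k, k < w.length → (rot w k).headD true = false → listLe (rot w k) w

/-- w = 1-min_w : w starts with 1 and is the lexicographically smallest
cyclic permutation of itself starting with 1. -/
def isOneMin (w : List Bool) : Prop :=
  w.headD false = true ∧
    ∀ k, k < w.length → (rot w k).headD false = true → listLe w (rot w k)

/-- v is the 0-max cyclic permutation of w. -/
def isZeroMaxOf (v w : List Bool) : Prop :=
  (∃ k, k < w.length ∧ v = rot w k) ∧ v.headD true = false ∧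
    ∀ k, k < w.length → (rot w k).headD true = false → listLe (rot w k) v

/-- u is the 1-min cyclic permutation of w. -/
def isOneMinOf (u w : List Bool) : Prop :=
  (∃ k, k < w.length ∧ u = rot w k) ∧ u.headD false = true ∧
    ∀ k, k < w.length → (rot w k).headD false = true → listLe u (rot w k)

/-- The periodic sequence w^∞. -/
def periodicSeq (w : List Bool) : Seq := fun i => w.getD (i % w.length) false

/-- The sequence w followed by x. -/
def wordThen (w : List Bool) (x : Seq) : Seq :=
  fun i => if i < w.length then w.getD i false else x (i - w.length)

/-- Prepend one symbol to a sequence (e.g. 0α, 1β). -/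
def consSeq (a : Bool) (x : Seq) : Seq := fun i => if i = 0 then a else x (i - 1)

/-- A word is balanced if any two factors of equal length have numbers of 1's
differing by at most one. -/
def balanced (w : List Bool) : Prop :=
  ∀ u v : List Bool, u <:+: w → v <:+: w → u.length = v.length →
    ((u.count true : ℤ) - (v.count true : ℤ)).natAbs ≤ 1

/-- A word is cyclically balanced if its square is balanced. -/
def cycBalanced (w : List Bool) : Prop := balanced (w ++ w)

/-- Infinite concatenation of a sequence of (nonempty) finite words. -/
noncomputable def concatSeq (b : ℕ → List Bool) : Seq := fun i =>
  (b (sInf {n : ℕ | i < ∑ k ∈ Finset.range (n + 1), (b k).length})).getD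
    (i - ∑ k ∈ Finset.range (sInf {n : ℕ | i < ∑ k ∈ Finset.range (n + 1), (b k).length}), (b k).length)
    false

/-- (α,β) is renormalisable by the finite words ω and ν:
ω = 0-max_ω, ν = 1-min_ν, (0-max_ν)^∞ ≺ ω^∞, ν^∞ ≺ (1-min_ω)^∞, ℓ(ων) ≥ 3, and
0α = ω ν^{n₁^ν} ω^{n₁^ω} ν^{n₂^ν} ⋯ and 1β = ν ω^{m₁^ω} ν^{m₁^ν} ⋯ with all
exponents in ℕ ∪ {∞}; equivalently 0α (resp. 1β) is an infinite concatenation of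
copies of ω and ν whose first two blocks are ω, ν (resp. ν, ω). -/
def RenormalisableBy (α β : Seq) (ω ν : List Bool) : Prop :=
  isZeroMax ω ∧ isOneMin ν ∧
  (∀ v, isZeroMaxOf v ν → lexLt (periodicSeq v) (periodicSeq ω)) ∧
  (∀ u, isOneMinOf u ω → lexLt (periodicSeq ν) (periodicSeq u)) ∧
  3 ≤ ω.length + ν.length ∧
  (∃ b : ℕ → List Bool, b 0 = ω ∧ b 1 = ν ∧ (∀ k, b k = ω ∨ b k = ν) ∧
    consSeq false α = concatSeq b) ∧
  (∃ c : ℕ → List Bool, c 0 = ν ∧ c 1 = ω ∧ (∀ k, c k = ω ∨ c k = ν) ∧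
    consSeq true β = concatSeq c)

/-- (α,β) is renormalisable by an infinite sequence: either 0α = ω and 1β = νω
with ω infinite and ν = 1-min_ν finite, or 0α = ων and 1β = ν with ν infinite
and ω = 0-max_ω finite. -/
def RenormInfBy (α β : Seq) : Prop :=
  (∃ ν : List Bool, isOneMin ν ∧ consSeq true β = wordThen ν (consSeq false α)) ∨
  (∃ ω : List Bool, isZeroMax ω ∧ consSeq false α = wordThen ω (consSeq true β))

/-- n_α = min{n ≥ 1 : σⁿα ≻ α}. -/
noncomputable def nAlpha (α : Seq) : ℕ := sInf {n | 1 ≤ n ∧ lexLt α (shift^[n] α)}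

/-- The periodic sequence (α₁ ⋯ α_{n-1} 0)^∞. -/
def cutZero (α : Seq) (n : ℕ) : Seq :=
  fun i => if i % n = n - 1 then false else α (i % n)

/-- The periodic sequence (β₁ ⋯ β_{n-1} 1)^∞. -/
def cutOne (β : Seq) (n : ℕ) : Seq :=
  fun i => if i % n = n - 1 then true else β (i % n)

open Classical in
/-- The map ς : Σ₂¹ → Σ₂¹. -/
noncomputable def varsigma (α : Seq) : Seq :=
  if α ∈ ParryP then α else cutZero α (nAlpha α)

/-- The map ς' : Σ₂⁰ → Σ₂⁰, ς'(β) = mirror of ς(β̄). -/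
noncomputable def varsigma' (β : Seq) : Seq := mirror (varsigma (mirror β))

/-- M_α(β) = min{m ≥ 1 : σ^m β ≻ α}. -/
noncomputable def Msub (α β : Seq) : ℕ := sInf {m | 1 ≤ m ∧ lexLt α (shift^[m] β)}

/-- N_β(α) = min{n ≥ 1 : σⁿ α ≺ β}. -/
noncomputable def Nsub (α β : Seq) : ℕ := sInf {n | 1 ≤ n ∧ lexLt (shift^[n] α) β}

/-- ι(α) = (α₁ ⋯ α_{N_β(α)-1} 0)^∞. -/
noncomputable def iotaA (α β : Seq) : Seq := cutZero α (Nsub α β)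

/-- ι(β) = (β₁ ⋯ β_{M_α(β)-1} 1)^∞. -/
noncomputable def iotaB (α β : Seq) : Seq := cutOne β (Msub α β)

/-- ξ_α(β) = (β₁ ⋯ β_{M-1} 1)^∞ with M = M_α(β). -/
noncomputable def xiA (α β : Seq) : Seq := cutOne β (Msub α β)

/-- ξ'_β(α) = (α₁ ⋯ α_{N-1} 0)^∞ with N = N_β(α). -/
noncomputable def xiB (α β : Seq) : Seq := cutZero α (Nsub α β)

/-- A two sided extremal pair. -/
def twoSidedExtremal (α β : Seq) : Prop :=
  (∃ n, 1 ≤ n ∧ lexLt α (shift^[n] β)) ∧ (∃ m, 1 ≤ m ∧ lexLt (shift^[m] α) β)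

/-- A right extremal pair. -/
def rightExtremal (α β : Seq) : Prop :=
  (∀ m, 1 ≤ m → lexLt β (shift^[m] α)) ∧ (∃ n, 1 ≤ n ∧ lexLt α (shift^[n] β))

/-- A left extremal pair. -/
def leftExtremal (α β : Seq) : Prop :=
  (∀ n, 1 ≤ n → lexLt (shift^[n] β) α) ∧ (∃ m, 1 ≤ m ∧ lexLt (shift^[m] α) β)

/-- Dyadic rationals. -/
def IsDyadic (t : ℝ) : Prop := ∃ (z : ℤ) (n : ℕ), t = (z : ℝ) / 2 ^ n

/-- α₁ ⋯ α_n 1^∞. -/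
def onesAfter (α : Seq) (n : ℕ) : Seq := fun i => if i < n then α i else true

end DoublingHole

namespace DoublingHole

/-! ### Shifts and the lexicographic order -/

theorem shift_iterate_apply (n : ℕ) (x : Seq) (i : ℕ) : shift^[n] x i = x (i + n) := by
  induction n generalizing i with
  | zero => rfl
  | succ n ih =>
    rw [Function.iterate_succ_apply', shift, ih]
    congr 1
    omega

theorem lexLt_iff (x y : Seq) : lexLt x y ↔ toLex x < toLex y := Iff.rfl

theorem lexLe_iff (x y : Seq) : lexLe x y ↔ toLex x ≤ toLex y := by
  rw [le_iff_lt_or_eq]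
  rfl

theorem not_lexLt {x y : Seq} : ¬ lexLt x y ↔ lexLe y x := by
  rw [lexLt_iff, lexLe_iff]
  exact not_lt

theorem lexLt.not_lexLe {x y : Seq} (h : lexLt x y) : ¬ lexLe y x := by
  rw [lexLe_iff, not_le]
  exact h

theorem lexLt.trans {x y z : Seq} (hxy : lexLt x y) (hyz : lexLt y z) : lexLt x z := by
  rw [lexLt_iff] at *
  exact hxy.trans hyz

/-- If `x ≼ y`, either they differ first before position `l`, or they agree up to there. -/
theorem lexLe.split {x y : Seq} (h : lexLe x y) (l : ℕ) :
    (∃ i < l, (∀ j < i, x j = y j) ∧ x i < y i) ∨ ∀ i < l, x i = y i := by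
  rcases h with ⟨k, hk, hlt⟩ | rfl
  · rcases lt_or_ge k l with h | h
    · exact Or.inl ⟨k, h, hk, hlt⟩
    · exact Or.inr fun i hi => hk i (hi.trans_le h)
  · exact Or.inr fun _ _ => rfl

theorem lexLe.apply_le {x y : Seq} (h : lexLe x y) {l : ℕ} (hl : ∀ i < l, x i = y i) :
    x l ≤ y l := by
  rcases h.split (l + 1) with ⟨i, hi, -, hlt⟩ | h
  · rcases Nat.lt_succ_iff_lt_or_eq.mp hi with hi | rfl
    · exact absurd (hl i hi) hlt.ne
    · exact hlt.le
  · exact (h l l.lt_succ_self).le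

theorem lexLt_shift_iff {x y : Seq} {l : ℕ} (hl : ∀ i < l, x i = y i) :
    lexLt (shift^[l] x) (shift^[l] y) ↔ lexLt x y := by
  constructor
  · rintro ⟨k, hk, hlt⟩
    simp only [shift_iterate_apply] at hk hlt
    refine ⟨k + l, fun i hi => ?_, hlt⟩
    rcases lt_or_ge i l with h | h
    · exact hl i h
    · have := hk (i - l) (by omega)
      rwa [Nat.sub_add_cancel h] at this
  · rintro ⟨k, hk, hlt⟩
    have h : l ≤ k := by
      by_contra! h
      exact hlt.ne (hl k h)
    refine ⟨k - l, fun i hi => ?_, ?_⟩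
    · simpa only [shift_iterate_apply] using hk (i + l) (by omega)
    · simpa only [shift_iterate_apply, Nat.sub_add_cancel h] using hlt

theorem lexLe_shift_iff {x y : Seq} {l : ℕ} (hl : ∀ i < l, x i = y i) :
    lexLe (shift^[l] x) (shift^[l] y) ↔ lexLe x y := by
  rw [← not_lexLt, ← not_lexLt, lexLt_shift_iff fun i hi => (hl i hi).symm]

/-! ### Mirror images -/

theorem mirror_mirror (x : Seq) : mirror (mirror x) = x := by
  funext i
  simp [mirror]

theorem shift_iterate_mirror (n : ℕ) (x : Seq) :
    shift^[n] (mirror x) = mirror (shift^[n] x) := by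
  funext i
  simp only [mirror, shift_iterate_apply]

theorem lexLt_mirror {x y : Seq} : lexLt (mirror x) (mirror y) ↔ lexLt y x := by
  have hlt : ∀ a b : Bool, (!a) < (!b) ↔ b < a := by decide
  simp only [lexLt, mirror, hlt, Bool.not_inj_iff]
  simp only [eq_comm]

theorem lexLe_mirror {x y : Seq} : lexLe (mirror x) (mirror y) ↔ lexLe y x := by
  rw [← not_lexLt, ← not_lexLt, lexLt_mirror]

theorem mem_barP_iff {β : Seq} :
    β ∈ barP ↔ β 0 = false ∧ ∀ n, 1 ≤ n → lexLe β (shift^[n] β) := by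
  simp only [barP, ParryP, Set.mem_ofPred_eq, shift_iterate_mirror, lexLe_mirror]
  simp [mirror]

theorem mirror_mem_barP {α : Seq} (h : α ∈ ParryP) : mirror α ∈ barP := by
  rwa [barP, Set.mem_ofPred_eq, mirror_mirror]

theorem inLW_of_mirror {α β : Seq} (h : inLW (mirror β) (mirror α)) : inLW α β := by
  obtain ⟨hβ, hα, h⟩ := h
  rw [barP, Set.mem_ofPred_eq, mirror_mirror] at hα
  refine ⟨hα, hβ, fun n hn => ?_⟩
  have := h n hn
  rw [shift_iterate_mirror, shift_iterate_mirror, lexLe_mirror, lexLe_mirror] at this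
  exact this.symm

theorem leftExtremal.mirror {α β : Seq} (h : leftExtremal α β) :
    rightExtremal (mirror β) (mirror α) := by
  simpa only [rightExtremal, leftExtremal, shift_iterate_mirror, lexLt_mirror] using h

theorem mirror_xiB (α β : Seq) : mirror (xiB α β) = xiA (mirror β) (mirror α) := by
  have hN : Msub (mirror β) (mirror α) = Nsub α β := by
    simp only [Msub, Nsub, shift_iterate_mirror, lexLt_mirror]
  funext i
  simp only [xiA, xiB, hN, mirror, cutOne, cutZero]
  split_ifs <;> rfl

/-! ### The periodic sequence `cutOne β M` -/

theorem cutOne_of_lt (β : Seq) {M i : ℕ} (hi : i < M - 1) : cutOne β M i = β i := by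
  rw [cutOne, Nat.mod_eq_of_lt (by omega), if_neg hi.ne]

theorem cutOne_last (β : Seq) {M : ℕ} (hM : 1 ≤ M) : cutOne β M (M - 1) = true := by
  rw [cutOne, Nat.mod_eq_of_lt (by omega), if_pos rfl]

theorem shift_mod_cutOne (β : Seq) (M n : ℕ) :
    shift^[n % M] (cutOne β M) = shift^[n] (cutOne β M) := by
  funext i
  simp only [shift_iterate_apply, cutOne, Nat.add_mod_mod]

theorem shift_self_cutOne (β : Seq) (M : ℕ) : shift^[M] (cutOne β M) = cutOne β M := by
  rw [← shift_mod_cutOne, Nat.mod_self]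
  rfl

/-- The digit of `β` just before the first tail exceeding `α` is zero. -/
theorem apply_pred_eq_false {α β : Seq} (hα : α ∈ ParryP) (hβ : β ∈ barP) {M : ℕ}
    (hgt : lexLt α (shift^[M] β))
    (hmin : ∀ k, 1 ≤ k → k < M → lexLe (shift^[k] β) α) : β (M - 1) = false := by
  rcases Nat.lt_or_ge 1 M with h | h
  · by_contra hne
    have h1 : ∀ i < 1, shift^[M - 1] β i = α i := by
      intro i hi
      obtain rfl : i = 0 := by omega
      rw [shift_iterate_apply, hα.1, Nat.zero_add]
      exact Bool.eq_true_of_not_eq_false hne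
    have h2 := (lexLe_shift_iff h1).mpr (hmin (M - 1) (by omega) (by omega))
    rw [← Function.iterate_add_apply, Nat.add_sub_cancel' h.le, lexLe_iff] at h2
    have h3 := hα.2 1 le_rfl
    rw [lexLe_iff] at h3
    exact hgt.not_lexLe ((lexLe_iff _ _).mpr (h2.trans h3))
  · rw [Nat.sub_eq_zero_of_le h]
    exact (mem_barP_iff.mp hβ).1

/-- Tails of `α` that stay above `β` also stay above the periodic sequence `cutOne β M`. -/
theorem cutOne_lexLe_shift {α β : Seq} (hα : α ∈ ParryP)
    (hab : ∀ m, 1 ≤ m → lexLt β (shift^[m] α)) {M : ℕ} (hM : 1 ≤ M)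
    (hgt : lexLt α (shift^[M] β)) (hlast : β (M - 1) = false) {m : ℕ} (hm : 1 ≤ m) :
    lexLe (cutOne β M) (shift^[m] α) := by
  rw [← not_lexLt]
  rintro ⟨k, hk, hlt⟩
  induction k using Nat.strong_induction_on generalizing m with
  | _ k ih =>
    rcases lt_trichotomy k (M - 1) with h | rfl | h
    · refine (hab m hm).not_lexLe (Or.inl ⟨k, fun i hi => ?_, ?_⟩)
      · rw [hk i hi, cutOne_of_lt β (hi.trans h)]
      · rwa [cutOne_of_lt β h] at hlt
    · have hagree : ∀ i < M, β i = shift^[m] α i := by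
        intro i hi
        rcases Nat.lt_or_ge i (M - 1) with h | h
        · rw [hk i h, cutOne_of_lt β h]
        · obtain rfl : i = M - 1 := by omega
          rw [hlast]
          exact (Bool.lt_iff.mp hlt).1.symm
      have h1 := (lexLt_shift_iff hagree).mpr (hab m hm)
      rw [← Function.iterate_add_apply] at h1
      exact (hgt.trans h1).not_lexLe (hα.2 (M + m) (by omega))
    · have hper : ∀ i, cutOne β M (i + M) = cutOne β M i := fun i => by
        rw [← shift_iterate_apply M (cutOne β M), shift_self_cutOne]
      refine ih (k - M) (by omega) (show 1 ≤ M + m by omega) (fun i hi => ?_) ?_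
      · rw [Function.iterate_add_apply, shift_iterate_apply, hk _ (by omega), hper]
      · rwa [Function.iterate_add_apply, shift_iterate_apply, Nat.sub_add_cancel (by omega),
          ← hper (k - M), Nat.sub_add_cancel (by omega)]

theorem cutOne_lexLe_shift_self {β : Seq} (hβ : β ∈ barP) {M : ℕ} (hM : 1 ≤ M)
    (hlast : β (M - 1) = false) (n : ℕ) :
    lexLe (cutOne β M) (shift^[n] (cutOne β M)) := by
  rw [← shift_mod_cutOne]
  have hkM : n % M < M := Nat.mod_lt _ hM
  generalize n % M = k at hkM
  rcases Nat.eq_zero_or_pos k with rfl | hk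
  · exact Or.inr rfl
  have hle := (mem_barP_iff.mp hβ).2 k hk
  have hξ : ∀ i < M - 1 - k, shift^[k] (cutOne β M) i = shift^[k] β i := fun i hi => by
    rw [shift_iterate_apply, shift_iterate_apply, cutOne_of_lt β (by omega)]
  rcases hle.split (M - 1 - k) with ⟨i, hi, hagree, hlt⟩ | hagree
  · refine Or.inl ⟨i, fun j hj => ?_, ?_⟩
    · rw [hξ j (by omega), ← hagree j hj, cutOne_of_lt β (by omega)]
    · rwa [hξ i hi, cutOne_of_lt β (by omega)]
  · refine Or.inl ⟨M - 1 - k, fun j hj => ?_, ?_⟩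
    · rw [hξ j hj, ← hagree j hj, cutOne_of_lt β (by omega)]
    · have h := hle.apply_le hagree
      rw [shift_iterate_apply, Nat.sub_add_cancel (by omega), hlast] at h
      rw [shift_iterate_apply, Nat.sub_add_cancel (by omega), cutOne_last β hM,
        cutOne_of_lt β (by omega), Bool.lt_iff]
      exact ⟨le_bot_iff.mp h, rfl⟩

theorem shift_cutOne_lexLe {α β : Seq} (hα : α ∈ ParryP) {M : ℕ} (hM : 1 ≤ M)
    (hgt : lexLt α (shift^[M] β)) (hmin : ∀ k, 1 ≤ k → k < M → lexLe (shift^[k] β) α)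
    (hlast : β (M - 1) = false) (hzero : cutOne β M 0 = false)
    (hle : ∀ m, 1 ≤ m → lexLe (cutOne β M) (shift^[m] α)) (n : ℕ) :
    lexLe (shift^[n] (cutOne β M)) α := by
  rw [← shift_mod_cutOne]
  have hkM : n % M < M := Nat.mod_lt _ hM
  generalize n % M = k at hkM
  rcases Nat.eq_zero_or_pos k with rfl | hk
  · refine Or.inl ⟨0, fun i hi => absurd hi i.not_lt_zero, ?_⟩
    rw [Bool.lt_iff]
    exact ⟨hzero, hα.1⟩
  have hξ : ∀ i < M - 1 - k, shift^[k] (cutOne β M) i = shift^[k] β i := fun i hi => by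
    rw [shift_iterate_apply, shift_iterate_apply, cutOne_of_lt β (by omega)]
  have hkα := hmin k hk hkM
  have hlen : M - k + k = M := Nat.sub_add_cancel hkM.le
  rcases hkα.split (M - 1 - k) with ⟨i, hi, hagree, hlt⟩ | hagree
  · refine Or.inl ⟨i, fun j hj => ?_, ?_⟩
    · rw [hξ j (by omega), hagree j hj]
    · rwa [hξ i hi]
  have hone : α (M - 1 - k) = true := by
    by_contra hne
    have hagree' : ∀ i < M - k, shift^[k] β i = α i := by
      intro i hi
      rcases Nat.lt_or_ge i (M - 1 - k) with h | h
      · exact hagree i h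
      · obtain rfl : i = M - 1 - k := by omega
        rw [shift_iterate_apply, Nat.sub_add_cancel (by omega), hlast]
        exact (Bool.eq_false_of_not_eq_true hne).symm
    have h1 := (lexLe_shift_iff hagree').mpr hkα
    rw [← Function.iterate_add_apply, hlen, lexLe_iff] at h1
    have h2 := hα.2 (M - k) (by omega)
    rw [lexLe_iff] at h2
    exact hgt.not_lexLe ((lexLe_iff _ _).mpr (h1.trans h2))
  have hagree' : ∀ i < M - k, shift^[k] (cutOne β M) i = α i := by
    intro i hi
    rcases Nat.lt_or_ge i (M - 1 - k) with h | h
    · rw [hξ i h, hagree i h]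
    · obtain rfl : i = M - 1 - k := by omega
      rw [shift_iterate_apply, Nat.sub_add_cancel (by omega), cutOne_last β hM, hone]
  rw [← lexLe_shift_iff hagree', ← Function.iterate_add_apply, hlen, shift_self_cutOne]
  exact hle (M - k) (by omega)

theorem rightExtremal.inLW_xiA {α β : Seq} (hα : α ∈ ParryP) (hβ : β ∈ barP)
    (h : rightExtremal α β) : inLW α (xiA α β) := by
  obtain ⟨hab, hne⟩ := h
  have hmem : 1 ≤ Msub α β ∧ lexLt α (shift^[Msub α β] β) := Nat.sInf_mem hne
  have hmin : ∀ k, 1 ≤ k → k < Msub α β → lexLe (shift^[k] β) α := fun k hk hkM =>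
    not_lexLt.mp fun hlt => Nat.notMem_of_lt_sInf hkM ⟨hk, hlt⟩
  rw [xiA]
  generalize Msub α β = M at hmem hmin
  obtain ⟨hM, hgt⟩ := hmem
  have hlast := apply_pred_eq_false hα hβ hgt hmin
  have hle : ∀ m, 1 ≤ m → lexLe (cutOne β M) (shift^[m] α) := fun m hm =>
    cutOne_lexLe_shift hα hab hM hgt hlast hm
  have hM2 : 1 < M := by
    by_contra hM1
    obtain rfl : M = 1 := by omega
    obtain ⟨k, -, hk⟩ := hgt
    have hαk : α k = false := (Bool.lt_iff.mp hk).1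
    have hk0 : 1 ≤ k := by
      by_contra hk0
      obtain rfl : k = 0 := by omega
      exact absurd (hα.1.symm.trans hαk) (by decide)
    have h0 := (hle k hk0).apply_le (l := 0) fun i hi => absurd hi i.not_lt_zero
    rw [shift_iterate_apply, Nat.zero_add, hαk, cutOne_last β le_rfl] at h0
    exact absurd h0 (by decide)
  have hzero : cutOne β M 0 = false := by
    rw [cutOne_of_lt β (by omega)]
    exact (mem_barP_iff.mp hβ).1
  exact ⟨hα, mem_barP_iff.mpr ⟨hzero, fun n _ => cutOne_lexLe_shift_self hβ hM hlast n⟩,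
    fun n hn => ⟨hle n hn, shift_cutOne_lexLe hα hM hgt hmin hlast hzero hle n⟩⟩

/-- for (α,β) ∈ P × P̄, (i) if (α,β) is right extremal then
(α, ξ_α(β)) ∈ LW; (ii) if (α,β) is left extremal then (ξ'_β(α), β) ∈ LW. -/
theorem statement12 (α β : Seq) (hα : α ∈ ParryP) (hβ : β ∈ barP) :
    (rightExtremal α β → inLW α (xiA α β)) ∧
    (leftExtremal α β → inLW (xiB α β) β) := by
  refine ⟨rightExtremal.inLW_xiA hα hβ, fun h => inLW_of_mirror ?_⟩
  rw [mirror_xiB]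
  exact h.mirror.inLW_xiA hβ (mirror_mem_barP hα)

end DoublingHole
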